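/- For all real numbers x and y with y > 0, the imaginary part of w(x + iy) equals L(x, y) = (1/√π) · ∫_{0}^{∞} exp(−t²/4) · exp(−yt) · sin(xt) dt, where in particular this integral converges. -/

import Mathlib

open Real Complex MeasureTheory intervalIntegral

open Real Complex MeasureTheory intervalIntegral

/-- The Faddeeva (complex error) function
`w(z) = e^{-z²} (1 + (2i/√π) ∫₀^z e^{s²} ds)`, where the contour integral from
`0` to `z` is taken along the straight-line segment (the integrand is entire, so
the integral is path-independent). -/
noncomputable def faddeeva (z : ℂ) : ℂ :=
  Complex.exp (-z ^ 2) *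
    (1 + (2 * Complex.I / (Real.sqrt Real.pi : ℂ)) *
      (z * ∫ u in (0 : ℝ)..1, Complex.exp (((u : ℂ) * z) ^ 2)))

lemma integrable_cexp_neg_sq_div_four_add (s : ℂ) :
    Integrable (fun t : ℝ => cexp (-(t : ℂ) ^ 2 / 4 + s * t)) := by
  have h := _root_.integrable_cexp_quadratic' (b := -1 / 4) (by norm_num) s 0
  refine h.congr (.of_forall fun t => ?_)
  dsimp only
  congr 1
  ring

lemma norm_cexp_neg_sq_div_four_add (s : ℂ) (t : ℝ) :
    ‖cexp (-(t : ℂ) ^ 2 / 4 + s * t)‖ = Real.exp (-t ^ 2 / 4 + s.re * t) := by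
  rw [Complex.norm_exp]
  congr 1
  have h : -(t : ℂ) ^ 2 / 4 + s * t = ((-t ^ 2 / 4 : ℝ) : ℂ) + s * t := by push_cast; ring
  rw [h, Complex.add_re, Complex.ofReal_re, Complex.re_mul_ofReal]

lemma integrable_exp_neg_sq_div_four_add (a : ℝ) :
    Integrable (fun t : ℝ => Real.exp (-t ^ 2 / 4 + a * t)) :=
  (integrable_cexp_neg_sq_div_four_add a).norm.congr
    (.of_forall fun t => by simpa using norm_cexp_neg_sq_div_four_add a t)

lemma norm_mul_cexp_neg_sq_div_four_add_le {s : ℂ} {a t : ℝ} (hs : s.re ≤ a) (ht : 0 < t) :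
    ‖(t : ℂ) * cexp (-(t : ℂ) ^ 2 / 4 + s * t)‖ ≤ Real.exp (-t ^ 2 / 4 + (a + 1) * t) := by
  rw [norm_mul, norm_cexp_neg_sq_div_four_add, Complex.norm_real, Real.norm_of_nonneg ht.le]
  calc t * Real.exp (-t ^ 2 / 4 + s.re * t)
      ≤ Real.exp t * Real.exp (-t ^ 2 / 4 + a * t) := by
        gcongr
        linarith [Real.add_one_le_exp t]
    _ = Real.exp (-t ^ 2 / 4 + (a + 1) * t) := by
        rw [← Real.exp_add]
        ring_nf

lemma integrableOn_mul_cexp_neg_sq_div_four_add (s : ℂ) :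
    IntegrableOn (fun t : ℝ => (t : ℂ) * cexp (-(t : ℂ) ^ 2 / 4 + s * t)) (Set.Ioi 0) := by
  refine (integrable_exp_neg_sq_div_four_add (s.re + 1)).integrableOn.mono'
    (Continuous.aestronglyMeasurable (by fun_prop)) ?_
  exact (ae_restrict_mem measurableSet_Ioi).mono fun t ht =>
    norm_mul_cexp_neg_sq_div_four_add_le le_rfl ht

/-- The Laplace transform of `exp (-t² / 4)` over the half-line, evaluated at `-s`. -/
noncomputable def halfGaussianTransform (s : ℂ) : ℂ :=
  ∫ t in Set.Ioi (0 : ℝ), cexp (-(t : ℂ) ^ 2 / 4 + s * t)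

lemma halfGaussianTransform_zero : halfGaussianTransform 0 = (√π : ℂ) := by
  have h := integral_gaussian_complex_Ioi (b := 1 / 4) (by norm_num)
  have h₁ : halfGaussianTransform 0 = ∫ t in Set.Ioi (0 : ℝ), cexp (-(1 / 4) * (t : ℂ) ^ 2) := by
    unfold halfGaussianTransform
    congr 1
    ext t
    congr 1
    ring
  have h₂ : ((π : ℂ) / (1 / 4)) = ((4 * π : ℝ) : ℂ) := by push_cast; ring
  have h₃ : √(4 * π) = 2 * √π := by
    rw [Real.sqrt_mul (by norm_num), show (4 : ℝ) = 2 ^ 2 by norm_num,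
      Real.sqrt_sq (by norm_num)]
  have h₄ : (((4 * π : ℝ) : ℂ) ^ (1 / 2 : ℂ)) = ((√(4 * π) : ℝ) : ℂ) := by
    rw [Real.sqrt_eq_rpow, Complex.ofReal_cpow (by positivity)]
    norm_num
  rw [h₁, h, h₂, h₄, h₃]
  push_cast
  ring

lemma integral_mul_cexp_neg_sq_div_four_add (s : ℂ) :
    ∫ t in Set.Ioi (0 : ℝ), (t : ℂ) * cexp (-(t : ℂ) ^ 2 / 4 + s * t) =
      2 + 2 * s * halfGaussianTransform s := by
  have hd : ∀ t : ℝ, HasDerivAt (fun t : ℝ => cexp (-(t : ℂ) ^ 2 / 4 + s * t))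
      (s * cexp (-(t : ℂ) ^ 2 / 4 + s * t) -
        1 / 2 * ((t : ℂ) * cexp (-(t : ℂ) ^ 2 / 4 + s * t))) t := by
    intro t
    have h₁ : HasDerivAt (fun t : ℝ => (t : ℂ)) 1 t := Complex.ofRealCLM.hasDerivAt
    have h₂ := (((h₁.pow 2).neg.div_const 4).add (h₁.const_mul s)).cexp
    refine h₂.congr_deriv ?_
    simp
    ring
  have hi := (integrable_cexp_neg_sq_div_four_add s).integrableOn (s := Set.Ioi 0)
  have hi' := integrableOn_mul_cexp_neg_sq_div_four_add s
  have hint := (hi.const_mul s).sub (hi'.const_mul (1 / 2))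
  have h0 := tendsto_zero_of_hasDerivAt_of_integrableOn_Ioi (fun t _ => hd t) hint hi
  have h := integral_Ioi_of_hasDerivAt_of_tendsto' (fun t _ => hd t) hint h0
  rw [integral_sub (hi.const_mul s) (hi'.const_mul (1 / 2)), MeasureTheory.integral_const_mul,
    MeasureTheory.integral_const_mul] at h
  change s * halfGaussianTransform s - _ = _ at h
  simp only [ofReal_zero, mul_zero, ne_eq, OfNat.ofNat_ne_zero, not_false_eq_true, zero_pow,
    neg_zero, zero_div, add_zero, Complex.exp_zero] at h
  linear_combination (-2) * h

lemma hasDerivAt_halfGaussianTransform (s : ℂ) :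
    HasDerivAt halfGaussianTransform (2 + 2 * s * halfGaussianTransform s) s := by
  rw [← integral_mul_cexp_neg_sq_div_four_add]
  refine (hasDerivAt_integral_of_dominated_loc_of_deriv_le (μ := volume.restrict (Set.Ioi (0 : ℝ)))
    (F := fun s (t : ℝ) => cexp (-(t : ℂ) ^ 2 / 4 + s * t))
    (F' := fun s (t : ℝ) => (t : ℂ) * cexp (-(t : ℂ) ^ 2 / 4 + s * t))
    (bound := fun t => Real.exp (-t ^ 2 / 4 + (s.re + 1 + 1) * t))
    (Metric.ball_mem_nhds s one_pos)
    (.of_forall fun z => (integrable_cexp_neg_sq_div_four_add z).1.restrict)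
    (integrable_cexp_neg_sq_div_four_add s).integrableOn
    (integrableOn_mul_cexp_neg_sq_div_four_add s).1 ?_
    (integrable_exp_neg_sq_div_four_add _).integrableOn ?_).2
  · refine (ae_restrict_mem measurableSet_Ioi).mono fun t ht z hz =>
      norm_mul_cexp_neg_sq_div_four_add_le ?_ ht
    have h₁ := Complex.re_le_norm (z - s)
    rw [Metric.mem_ball, dist_eq_norm] at hz
    rw [Complex.sub_re] at h₁
    linarith
  · refine .of_forall fun t z _ => ?_
    have h := (((hasDerivAt_id z).mul_const (t : ℂ)).const_add (-(t : ℂ) ^ 2 / 4)).cexp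
    refine h.congr_deriv ?_
    simp
    ring

lemma faddeeva_eq_halfGaussianTransform (z : ℂ) :
    faddeeva z = 1 / (√π : ℂ) * halfGaussianTransform (Complex.I * z) := by
  have hd : ∀ u : ℝ, HasDerivAt
      (fun u : ℝ => cexp (((u : ℂ) * z) ^ 2) * halfGaussianTransform (Complex.I * (u * z)))
      (2 * Complex.I * z * cexp (((u : ℂ) * z) ^ 2)) u := by
    intro u
    have h₁ : HasDerivAt (fun u : ℝ => (u : ℂ) * z) (1 * z) u :=
      HasDerivAt.mul_const Complex.ofRealCLM.hasDerivAt z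
    have h₂ := (h₁.pow 2).cexp
    have h₃ := (hasDerivAt_halfGaussianTransform _).comp u (h₁.const_mul Complex.I)
    refine (h₂.mul h₃).congr_deriv ?_
    simp only [Function.comp_apply]
    push_cast
    linear_combination (2 * u * z ^ 2 * cexp (((u : ℂ) * z) ^ 2) *
      halfGaussianTransform (Complex.I * (u * z))) * Complex.I_sq
  have h := integral_eq_sub_of_hasDerivAt (a := 0) (b := 1) (fun u _ => hd u)
    (Continuous.intervalIntegrable (by fun_prop) _ _)
  rw [intervalIntegral.integral_const_mul] at h
  simp only [ofReal_one, one_mul, ofReal_zero, zero_mul, mul_zero, halfGaussianTransform_zero,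
    ne_eq, OfNat.ofNat_ne_zero, not_false_eq_true, zero_pow, Complex.exp_zero] at h
  have hπ : (√π : ℂ) ≠ 0 := by exact_mod_cast (Real.sqrt_pos.2 Real.pi_pos).ne'
  have he : cexp (-z ^ 2) * cexp (z ^ 2) = 1 := by rw [← Complex.exp_add]; simp
  rw [faddeeva]
  generalize (∫ u in (0 : ℝ)..1, cexp (((u : ℂ) * z) ^ 2)) = J at h ⊢
  generalize halfGaussianTransform (Complex.I * z) = H at h ⊢
  field_simp
  linear_combination cexp (-z ^ 2) * h + H * he

theorem im_faddeeva_eq_L (x y : ℝ) (hy : 0 < y) :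
    MeasureTheory.IntegrableOn
      (fun t : ℝ => Real.exp (-t ^ 2 / 4) * Real.exp (-y * t) * Real.sin (x * t))
      (Set.Ioi 0) ∧
    (faddeeva ((x : ℂ) + (y : ℂ) * Complex.I)).im =
      (1 / Real.sqrt Real.pi) *
        ∫ t in Set.Ioi (0 : ℝ),
          Real.exp (-t ^ 2 / 4) * Real.exp (-y * t) * Real.sin (x * t) := by
  have him : ∀ t : ℝ, (cexp (-(t : ℂ) ^ 2 / 4 + Complex.I * (x + y * Complex.I) * t)).im =
      Real.exp (-t ^ 2 / 4) * Real.exp (-y * t) * Real.sin (x * t) := by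
    intro t
    have h : -(t : ℂ) ^ 2 / 4 + Complex.I * (x + y * Complex.I) * t =
        ((-t ^ 2 / 4 + -y * t : ℝ) : ℂ) + ((x * t : ℝ) : ℂ) * Complex.I := by
      push_cast
      linear_combination (y * t : ℂ) * Complex.I_sq
    rw [h, Complex.exp_im, ← Real.exp_add, Complex.add_re, Complex.add_im, Complex.ofReal_re,
      Complex.ofReal_im, Complex.re_ofReal_mul, Complex.im_ofReal_mul, Complex.I_re, Complex.I_im,
      mul_zero, add_zero, zero_add, mul_one]
  have hi := (integrable_cexp_neg_sq_div_four_add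
    (Complex.I * (x + y * Complex.I))).integrableOn (s := Set.Ioi 0)
  refine ⟨hi.im.congr (.of_forall him), ?_⟩
  have h := integral_im hi
  rw [faddeeva_eq_halfGaussianTransform, ← Complex.ofReal_one, ← Complex.ofReal_div,
    Complex.im_ofReal_mul]
  congr 1
  refine h.symm.trans ?_
  congr 1
  ext t
  exact him t
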